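/- For the 6-state 2-symbol Turing machine M with transition table δ(A,0)=(1,R,B), δ(A,1)=(0,L,B), δ(B,0)=(0,R,C), δ(B,1)=(1,L,B), δ(C,0)=(1,R,D), δ(C,1)=(0,L,A), δ(D,0)=(1,L,E), δ(D,1)=(1,L,F), δ(E,0)=(1,L,A), δ(E,1)=(0,L,D), δ(F,0)=(1,R,H), δ(F,1)=(1,L,E): started in state A on the all-blank tape the machine reaches a configuration C(1) in exactly 1 step; and for every natural number k: from any configuration C(3k) it reaches a configuration C(9·2^(k+1) − 8) in exactly 54·4^(k+1) − 27·2^(k+3) + 26k + 86 steps; from any configuration C(3k+1) it reaches a configuration C(2^(k+5) − 8) in exactly 2048·(4^k − 1)/3 − 3·2^(k+7) + 26k + 792 steps; and from any configuration C(3k+2) it halts in exactly 3k+8 steps, the final tape reading left to right (all other cells blank): 1, the halted head scanning a cell containing 1, then k consecutive blocks 0,1,1, then 0,1,0,1. -/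

import Mathlib

/-- Move direction of the tape head. -/
inductive Dir : Type
  | L
  | R

/-- The head displacement of a direction. -/
def Dir.move : Dir → ℤ
  | Dir.L => -1
  | Dir.R => 1

/-- A Turing machine with `n` states and `k` symbols, in Rado's busy beaver model.
States are `Fin n` (state `A` is `0`, `B` is `1`, ...), symbols are `Fin k` with `0`
the blank symbol. A transition yields the written symbol, the move direction and the
next state, where `none` denotes the halting state `H`. -/
abbrev Machine (n k : ℕ) : Type :=
  Fin n → Fin k → Fin k × Dir × Option (Fin n)

/-- A configuration: current state (`none` = halted), head position, tape. -/
structure Cfg (n k : ℕ) where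
  state : Option (Fin n)
  pos : ℤ
  tape : ℤ → Fin k

/-- One computation step (halted configurations are fixed). -/
def step {n k : ℕ} (M : Machine n k) (c : Cfg n k) : Cfg n k :=
  match c.state with
  | none => c
  | some q =>
      { state := (M q (c.tape c.pos)).2.2
        pos := c.pos + (M q (c.tape c.pos)).2.1.move
        tape := Function.update c.tape c.pos (M q (c.tape c.pos)).1 }

/-- The initial configuration: state `A`, head at cell `0`, all-blank tape. -/
def init (n k : ℕ) [NeZero k] : Cfg n k :=
  { state := if h : 0 < n then some ⟨0, h⟩ else none
    pos := 0
    tape := fun _ => 0 }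

/-- `HaltsIn M c t`: started from `c`, the machine `M` halts after exactly `t` steps. -/
def HaltsIn {n k : ℕ} (M : Machine n k) (c : Cfg n k) (t : ℕ) : Prop :=
  ((step M)^[t] c).state = none ∧ ∀ i < t, ((step M)^[i] c).state ≠ none

/-- The number of non-blank cells of a configuration. -/
noncomputable def sigmaCount {n k : ℕ} [NeZero k] (c : Cfg n k) : ℕ :=
  Set.ncard {i : ℤ | c.tape i ≠ 0}

/-- Marxen and Buntrock's second 6-state 2-symbol machine
(states `A,B,C,D,E,F` are `0,1,2,3,4,5`; `none` is the halting state `H`). -/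
def M : Machine 6 2 :=
  ![![(1, Dir.R, some 1), (0, Dir.L, some 1)],
    ![(0, Dir.R, some 2), (1, Dir.L, some 1)],
    ![(1, Dir.R, some 3), (0, Dir.L, some 0)],
    ![(1, Dir.L, some 4), (1, Dir.L, some 5)],
    ![(1, Dir.L, some 0), (0, Dir.L, some 3)],
    ![(1, Dir.R, none), (1, Dir.L, some 4)]]

/-- The configuration `C(n)` with head at cell `p`: state `B`, scanned cell blank,
the `n` cells immediately to the left of the head all contain `1`, all other cells blank. -/
def Cf (n : ℕ) (p : ℤ) : Cfg 6 2 :=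
  { state := some 1
    pos := p
    tape := fun i => if p - n ≤ i ∧ i < p then 1 else 0 }

/-- The configuration with state `q`, head at cell `p`, the cells left of the head reading `l`
(nearest first) and the cells from the head rightwards reading `r`, all other cells blank. -/
def listCfg (c : Option (Fin 6) × List (Fin 2) × List (Fin 2)) (p : ℤ) : Cfg 6 2 :=
  { state := c.1
    pos := p
    tape := fun i => if i < p then c.2.1.getD (p - 1 - i).toNat 0
      else c.2.2.getD (i - p).toNat 0 }

/-- One computation step on list descriptions of configurations. -/
def listStep (c : Option (Fin 6) × List (Fin 2) × List (Fin 2)) :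
    Option (Fin 6) × List (Fin 2) × List (Fin 2) :=
  match c with
  | (none, l, r) => (none, l, r)
  | (some q, l, r) =>
    match M q (r.headD 0) with
    | (b, Dir.R, s) => (s, b :: l, r.tail)
    | (b, Dir.L, s) => (s, l.tail, l.headD 0 :: b :: r.tail)

/-- `M` goes from `c` to `d` in `t` steps, up to translation of the tape. -/
def Run (t : ℕ) (c d : Option (Fin 6) × List (Fin 2) × List (Fin 2)) : Prop :=
  ∀ p, ∃ p', (step M)^[t] (listCfg c p) = listCfg d p'

theorem Run.trans {s t : ℕ} {c d e : Option (Fin 6) × List (Fin 2) × List (Fin 2)}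
    (h₁ : Run s c d) (h₂ : Run t d e) : Run (s + t) c e := by
  intro p
  obtain ⟨p₁, h₁⟩ := h₁ p
  obtain ⟨p₂, h₂⟩ := h₂ p₁
  exact ⟨p₂, by rw [add_comm, Function.iterate_add_apply, h₁, h₂]⟩

theorem Run.cast {s t : ℕ} {c d : Option (Fin 6) × List (Fin 2) × List (Fin 2)}
    (h : Run s c d) (hst : s = t) : Run t c d := hst ▸ h

theorem step_listCfg_right (q : Fin 6) (l r : List (Fin 2)) (p : ℤ) (b : Fin 2)
    (s : Option (Fin 6)) (h : M q (r.headD 0) = (b, Dir.R, s)) :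
    step M (listCfg (some q, l, r) p) = listCfg (s, b :: l, r.tail) (p + 1) := by
  have hr : r.getD 0 0 = r.headD 0 := by cases r <;> rfl
  simp only [step, listCfg, lt_irrefl, if_false, sub_self, Int.toNat_zero, hr, h, Dir.move]
  congr 1
  funext i
  rcases lt_trichotomy i p with hi | rfl | hi
  · have e : (p + 1 - 1 - i).toNat = (p - 1 - i).toNat + 1 := by omega
    rw [Function.update_of_ne hi.ne, if_pos hi, if_pos (by omega), e, List.getD_cons_succ]
  · simp
  · have e : (i - p).toNat = (i - (p + 1)).toNat + 1 := by omega
    rw [Function.update_of_ne hi.ne', if_neg (by omega), if_neg (by omega), e]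
    cases r <;> simp

theorem step_listCfg_left (q : Fin 6) (l r : List (Fin 2)) (p : ℤ) (b : Fin 2)
    (s : Option (Fin 6)) (h : M q (r.headD 0) = (b, Dir.L, s)) :
    step M (listCfg (some q, l, r) p) =
      listCfg (s, l.tail, l.headD 0 :: b :: r.tail) (p - 1) := by
  have hr : r.getD 0 0 = r.headD 0 := by cases r <;> rfl
  simp only [step, listCfg, lt_irrefl, if_false, sub_self, Int.toNat_zero, hr, h, Dir.move]
  congr 1
  funext i
  rcases lt_trichotomy i p with hi | rfl | hi
  · rw [Function.update_of_ne hi.ne, if_pos hi]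
    rcases eq_or_ne i (p - 1) with rfl | hi'
    · cases l <;> simp
    · have e : (p - 1 - i).toNat = (p - 1 - 1 - i).toNat + 1 := by omega
      rw [if_pos (by omega), e]
      cases l <;> simp
  · simp
  · have e : (i - (p - 1)).toNat = (i - p - 1).toNat + 2 := by omega
    have e' : (i - p).toNat = (i - p - 1).toNat + 1 := by omega
    rw [Function.update_of_ne hi.ne', if_neg (by omega), if_neg (by omega), e, e']
    cases r <;> simp

theorem run_listStep (c : Option (Fin 6) × List (Fin 2) × List (Fin 2)) :
    Run 1 c (listStep c) := by
  intro p
  obtain ⟨_ | q, l, r⟩ := c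
  · exact ⟨p, rfl⟩
  · rcases h : M q (r.headD 0) with ⟨b, _ | _, s⟩
    · exact ⟨p - 1, by simp only [listStep, h]; exact step_listCfg_left q l r p b s h⟩
    · exact ⟨p + 1, by simp only [listStep, h]; exact step_listCfg_right q l r p b s h⟩

theorem run_listStep_iterate (t : ℕ) (c : Option (Fin 6) × List (Fin 2) × List (Fin 2)) :
    Run t c (listStep^[t] c) := by
  induction t with
  | zero => exact fun p => ⟨p, rfl⟩
  | succ t ih =>
    rw [Function.iterate_succ_apply']
    exact ih.trans (run_listStep _)

/-- `ones n l` is `l` preceded by `n` ones. -/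
def ones (n : ℕ) (l : List (Fin 2)) : List (Fin 2) := List.replicate n 1 ++ l

theorem ones_succ (n : ℕ) (l : List (Fin 2)) : ones (n + 1) l = 1 :: ones n l := rfl

theorem ones_cons (n : ℕ) (l : List (Fin 2)) : ones n (1 :: l) = ones (n + 1) l := by
  induction n with
  | zero => rfl
  | succ n ih => rw [ones_succ, ih]; rfl

/-- `pairs k l` is `l` preceded by `k` copies of the block `110`. -/
def pairs (k : ℕ) (l : List (Fin 2)) : List (Fin 2) := (fun r => 1 :: 1 :: 0 :: r)^[k] l

theorem pairs_succ (k : ℕ) (l : List (Fin 2)) :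
    pairs (k + 1) l = 1 :: 1 :: 0 :: pairs k l := Function.iterate_succ_apply' _ _ _

theorem Cf_eq_listCfg (n : ℕ) (p : ℤ) : Cf n p = listCfg (some 1, ones n [], [0]) p := by
  simp only [Cf, listCfg]
  congr 1
  funext i
  by_cases hi : i < p
  · by_cases hn : p - n ≤ i
    · have : (p - 1 - i).toNat < n := by omega
      simp [hi, hn, ones, this]
    · have : ¬ (p - 1 - i).toNat < n := by omega
      simp [hi, hn, ones, this]
  · simp only [hi, and_false, if_false]
    rcases (i - p).toNat with _ | m <;> simp

theorem run_B_right (n : ℕ) (l r : List (Fin 2)) :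
    Run (3 * n) (some 1, l, 0 :: ones n r) (some 1, ones n l, 0 :: r) := by
  induction n generalizing l with
  | zero => exact run_listStep_iterate 0 _
  | succ n ih =>
    have h : Run 3 (some 1, l, 0 :: 1 :: ones n r) (some 1, 1 :: l, 0 :: ones n r) :=
      run_listStep_iterate 3 _
    have := h.trans (ih (1 :: l))
    rw [ones_cons] at this
    exact this.cast (by ring)

theorem run_B_left (n : ℕ) (r : List (Fin 2)) :
    Run (n + 1) (some 1, ones n [], 1 :: r) (some 1, [], 0 :: ones (n + 1) r) := by
  induction n generalizing r with
  | zero => exact run_listStep_iterate 1 _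
  | succ n ih =>
    have h : Run 1 (some 1, 1 :: ones n [], 1 :: r) (some 1, ones n [], 1 :: 1 :: r) :=
      run_listStep_iterate 1 _
    have := h.trans (ih (1 :: r))
    rw [ones_cons] at this
    exact this.cast (by ring)

theorem run_shorten (m : ℕ) (r : List (Fin 2)) :
    Run (4 * m + 9) (some 1, [], 0 :: ones (m + 1) (0 :: 1 :: r))
      (some 1, [], 0 :: ones m (0 :: 1 :: 1 :: 1 :: r)) := by
  have h₁ := run_B_right (m + 1) [] (0 :: 1 :: r)
  cases m with
  | zero => exact h₁.trans (run_listStep_iterate 6 _)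
  | succ m =>
    have h₂ : Run 6 (some 1, ones (m + 1 + 1) [], 0 :: 0 :: 1 :: r)
        (some 1, ones m [], 1 :: 0 :: 1 :: 1 :: 1 :: r) := run_listStep_iterate 6 _
    exact ((h₁.trans h₂).trans (run_B_left m _)).cast (by ring)

theorem run_merge (m j : ℕ) (r : List (Fin 2)) :
    Run (2 * m ^ 2 + 7 * m + 8) (some 1, [], 0 :: ones m (0 :: ones (j + 1) r))
      (some 1, [], 0 :: ones (2 * m + j + 4) r) := by
  induction m generalizing j with
  | zero =>
    rw [show 2 * 0 + j + 4 = j + 1 + 1 + 1 + 1 by ring]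
    exact run_listStep_iterate 8 _
  | succ m ih =>
    have := (run_shorten m (ones j r)).trans (ih (j + 2))
    rw [show 2 * m + (j + 2) + 4 = 2 * (m + 1) + j + 4 by ring] at this
    exact this.cast (by ring)

theorem run_merge_pairs (k m : ℕ) (r : List (Fin 2)) :
    ∃ t m' : ℕ, m' + 5 = (m + 5) * 2 ^ k ∧
      3 * (t : ℤ) = 2 * (m + 5) ^ 2 * (4 ^ k - 1) - 39 * (m + 5) * (2 ^ k - 1) + 69 * k ∧
      Run t (some 1, [], 0 :: ones m (0 :: pairs k r)) (some 1, [], 0 :: ones m' (0 :: r)) := by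
  induction k generalizing m with
  | zero => exact ⟨0, m, by simp, by simp, run_listStep_iterate 0 _⟩
  | succ k ih =>
    obtain ⟨t, m', hm, ht, h⟩ := ih (2 * m + 1 + 4)
    rw [pairs_succ]
    refine ⟨_, m', ?_, ?_, (run_merge m 1 (0 :: pairs k r)).trans h⟩
    · rw [hm]; ring
    · push_cast at ht ⊢
      rw [mul_add, ht]
      ring

theorem run_merge_all (k m : ℕ) :
    ∃ t n : ℕ, n + 8 = 4 * (m + 5) * 2 ^ k ∧
      3 * (t : ℤ) = 32 * (m + 5) ^ 2 * 4 ^ k - 2 * (m + 5) ^ 2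
        - 144 * (m + 5) * 2 ^ k + 39 * (m + 5) + 69 * k + 111 ∧
      Run t (some 1, [], 0 :: ones m (0 :: pairs k [1, 0, 1])) (some 1, ones n [], [0]) := by
  obtain ⟨t, m', hm, ht, h⟩ := run_merge_pairs k m [1, 0, 1]
  refine ⟨_, _, ?_, ?_, ((h.trans (run_merge m' 0 [0, 1])).trans
    (run_merge (2 * m' + 0 + 4) 0 [])).trans (run_B_right _ [] [])⟩
  · linarith
  · have e : (m' : ℤ) = (m + 5) * 2 ^ k - 5 := by
      have : ((m' + 5 : ℕ) : ℤ) = ((m + 5) * 2 ^ k : ℕ) := by rw [hm]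
      push_cast at this
      linarith
    have e4 : (4 : ℤ) ^ k = (2 ^ k) ^ 2 := by rw [← pow_mul, mul_comm, pow_mul]; norm_num
    push_cast
    rw [e]
    simp only [mul_add]
    rw [ht, e4]
    ring

theorem run_E_left (k : ℕ) (l r : List (Fin 2)) :
    Run (3 * k) (some 4, ones (3 * k) l, 1 :: r) (some 4, l, 1 :: pairs k r) := by
  induction k generalizing r with
  | zero => exact run_listStep_iterate 0 _
  | succ k ih =>
    have h : Run 3 (some 4, ones (3 * k + 3) l, 1 :: r)
        (some 4, ones (3 * k) l, 1 :: 1 :: 1 :: 0 :: r) := run_listStep_iterate 3 _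
    exact (h.trans (ih _)).cast (by ring)

theorem run_start (n : ℕ) :
    Run 5 (some 1, ones (n + 1) [], [0]) (some 4, ones n [], [1, 1, 0, 1]) :=
  run_listStep_iterate 5 _

theorem run_start_left (k : ℕ) (n : ℕ) :
    Run (3 * k + 5) (some 1, ones (3 * k + n + 1) [], [0])
      (some 4, ones n [], 1 :: pairs k [1, 0, 1]) := by
  have h := run_E_left k (ones n []) [1, 0, 1]
  rw [show ones (3 * k) (ones n []) = ones (3 * k + n) [] by simp [ones]] at h
  exact ((run_start _).trans h).cast (by ring)

theorem getD_pairs (k n : ℕ) :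
    (0 :: pairs k [1, 0, 1]).getD n 0 =
      if (n < 3 * k ∧ n % 3 ≠ 0) ∨ n = 3 * k + 1 ∨ n = 3 * k + 3 then (1 : Fin 2) else 0 := by
  induction k generalizing n with
  | zero =>
    rcases n with _ | _ | _ | _ | n <;> simp [pairs]
  | succ k ih =>
    rw [pairs_succ]
    rcases n with _ | _ | _ | n
    · simp
    · simp [show 1 < 3 * (k + 1) by omega]
    · simp [show 2 < 3 * (k + 1) by omega]
    · rw [List.getD_cons_succ, List.getD_cons_succ, List.getD_cons_succ, ih]
      congr 1
      apply propext
      omega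

theorem step_iterate_of_state_eq_none (c : Cfg 6 2) (h : c.state = none) (t : ℕ) :
    (step M)^[t] c = c :=
  Function.iterate_fixed (by simp [step, h]) t

theorem haltsIn_succ {c : Cfg 6 2} {t : ℕ} (h : ((step M)^[t] c).state ≠ none)
    (h' : ((step M)^[t + 1] c).state = none) : HaltsIn M c (t + 1) := by
  refine ⟨h', fun i hi hn => h ?_⟩
  rw [show t = (t - i) + i by omega, Function.iterate_add_apply,
    step_iterate_of_state_eq_none _ hn, hn]

/-- Analysis of Marxen and Buntrock's second machine: the blank tape leads to `C(1)` in
one step; `C(3k) ⊢(54·4^{k+1} - 27·2^{k+3} + 26k + 86) C(9·2^{k+1} - 8)`;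
`C(3k+1) ⊢(2048·(4^k - 1)/3 - 3·2^{k+7} + 26k + 792) C(2^{k+5} - 8)`; and from `C(3k+2)`
the machine halts in exactly `3k+8` steps with final tape `…0 1 (H1) (011)^k 0101 0…`. -/
theorem marxen_buntrock_second_analysis :
    (∃ q : ℤ, (step M)^[1] (init 6 2) = Cf 1 q) ∧
    ∀ k : ℕ, ∀ p : ℤ,
      (∃ q : ℤ, (step M)^[54 * 4 ^ (k + 1) - 27 * 2 ^ (k + 3) + 26 * k + 86]
          (Cf (3 * k) p) = Cf (9 * 2 ^ (k + 1) - 8) q) ∧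
      (∃ t : ℕ, (t : ℤ) = 2048 * (4 ^ k - 1) / 3 - 3 * 2 ^ (k + 7) + 26 * k + 792 ∧
        ∃ q : ℤ, (step M)^[t] (Cf (3 * k + 1) p) = Cf (2 ^ (k + 5) - 8) q) ∧
      (HaltsIn M (Cf (3 * k + 2) p) (3 * k + 8) ∧
        ∃ q : ℤ, (step M)^[3 * k + 8] (Cf (3 * k + 2) p) =
          { state := none
            pos := q + 1
            tape := fun i =>
              if i = q ∨ i = q + 1 ∨
                  (q + 2 ≤ i ∧ i ≤ q + 3 * k + 1 ∧ (i - q - 2) % 3 ≠ 0) ∨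
                  i = q + 3 * k + 3 ∨ i = q + 3 * k + 5 then 1 else 0 }) := by
  refine ⟨?_, fun k p => ⟨?_, ?_, ?_⟩⟩
  · have e : init 6 2 = listCfg (some 0, [], [0, 0]) 0 := by
      simp only [init, listCfg]
      congr 1
      funext i
      rcases (i - 0).toNat with _ | _ | m <;> simp
    simp only [e, Cf_eq_listCfg]
    exact run_listStep_iterate 1 _ 0
  · simp only [Cf_eq_listCfg]
    cases k with
    | zero =>
      have h₁ : Run 9 (some 1, ones 0 [], [0]) (some 1, [], 0 :: ones 3 (0 :: ones 1 [])) :=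
        run_listStep_iterate 9 _
      exact ((h₁.trans (run_merge 3 0 [])).trans (run_B_right 10 [] [])) p
    | succ k =>
      obtain ⟨t, n, hn, ht, h⟩ := run_merge_all k 4
      have h₁ : Run 7 (some 4, ones 2 [], 1 :: pairs k [1, 0, 1])
        (some 1, [], 0 :: ones 4 (0 :: pairs k [1, 0, 1])) := run_listStep_iterate 7 _
      have e : 9 * 2 ^ (k + 1 + 1) - 8 = n := by rw [pow_succ, pow_succ]; omega
      rw [e]
      refine (((run_start_left k 2).trans h₁).trans h).cast ?_ p
      have hle : 2 ^ k ≤ 4 ^ k := Nat.pow_le_pow_left (by norm_num) k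
      have ht' : 3 * t + 1296 * 2 ^ k = 2592 * 4 ^ k + 69 * k + 300 := by
        zify
        push_cast at ht
        linarith
      simp only [pow_add]
      omega
  · simp only [Cf_eq_listCfg]
    obtain ⟨t, n, hn, ht, h⟩ := run_merge_all k 3
    have h₁ : Run 6 (some 4, ones 0 [], 1 :: pairs k [1, 0, 1])
      (some 1, [], 0 :: ones 3 (0 :: pairs k [1, 0, 1])) := run_listStep_iterate 6 _
    have e : 2 ^ (k + 5) - 8 = n := by rw [pow_add]; omega
    refine ⟨_, ?_, e ▸ ((run_start_left k 0).trans h₁).trans h p⟩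
    have : (3 : ℤ) ∣ 4 ^ k - 1 := by simpa using sub_dvd_pow_sub_pow (4 : ℤ) 1 k
    obtain ⟨c, hc⟩ := this
    have e' : (4 : ℤ) ^ k = 3 * c + 1 := by linarith
    rw [e'] at ht
    rw [show 2048 * ((4 : ℤ) ^ k - 1) / 3 = 2048 * c by rw [hc]; omega]
    push_cast at ht ⊢
    rw [pow_add]
    linarith
  · simp only [Cf_eq_listCfg]
    have h := run_start_left k 1
    have h₁ : Run 2 (some 4, ones 1 [], 1 :: pairs k [1, 0, 1])
      (some 5, [], 0 :: 1 :: 0 :: pairs k [1, 0, 1]) := run_listStep_iterate 2 _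
    obtain ⟨p₁, h₂⟩ := h.trans h₁ p
    have h₃ := step_listCfg_right 5 [] (0 :: 1 :: 0 :: pairs k [1, 0, 1]) p₁ 1 none rfl
    have h₄ : (step M)^[3 * k + 8] (listCfg (some 1, ones (3 * k + 2) [], [0]) p) =
        listCfg (none, [1], 1 :: 0 :: pairs k [1, 0, 1]) (p₁ + 1) := by
      rw [show 3 * k + 8 = (3 * k + 5 + 2) + 1 by ring, Function.iterate_succ_apply', h₂, h₃]
      rfl
    refine ⟨haltsIn_succ (t := 3 * k + 7) ?_ ?_, p₁, ?_⟩
    · rw [h₂]; simp [listCfg]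
    · rw [h₄]; rfl
    · rw [h₄]
      simp only [listCfg]
      congr 1
      funext i
      rcases lt_trichotomy i p₁ with hi | rfl | hi
      · have e : (p₁ + 1 - 1 - i).toNat = (p₁ - i - 1).toNat + 1 := by omega
        rw [if_pos (by omega), if_neg (by omega), e]
        simp
      · simp
      · rw [if_neg (by omega)]
        rcases eq_or_ne i (p₁ + 1) with rfl | hi'
        · simp
        · rw [show (i - (p₁ + 1)).toNat = (i - p₁ - 2).toNat + 1 by omega, List.getD_cons_succ,
            getD_pairs]
          congr 1
          apply propext
          omega
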